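/- Let A be an antichain of ternary strings of ordinal length, i.e., a set of functions s : β → {0,1,2} (β an ordinal) that are pairwise incomparable under the extension relation ⊑. Then there exist an antichain B of binary strings of ordinal length and an order isomorphism from (A, ≤lex) onto (B, ≤lex). -/

import Mathlib

/-- A string of ordinal length over the alphabet `{0, …, m-1}`: a function
`s : β → Fin m` where `β` is an ordinal. -/
structure OrdStr (m : ℕ) where
  len : Ordinal
  val : ∀ ξ : Ordinal, ξ < len → Fin m

/-- `t` extends `s` (`s ⊑ t`): `s` equals the restriction of `t` to the domain of `s`. -/
def StrExt {m : ℕ} (s t : OrdStr m) : Prop :=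
  ∃ h : s.len ≤ t.len, ∀ ξ (hξ : ξ < s.len), s.val ξ hξ = t.val ξ (lt_of_lt_of_le hξ h)

/-- Strict lexicographic order: there is `ξ` in both domains with `s↾ξ = t↾ξ`
and `s ξ < t ξ`. -/
def StrLexLt {m : ℕ} (s t : OrdStr m) : Prop :=
  ∃ (ξ : Ordinal) (hs : ξ < s.len) (ht : ξ < t.len),
    (∀ η (hη : η < ξ), s.val η (hη.trans hs) = t.val η (hη.trans ht)) ∧
    s.val ξ hs < t.val ξ ht

/-- Non-strict lexicographic order. -/
def StrLexLe {m : ℕ} (s t : OrdStr m) : Prop := s = t ∨ StrLexLt s t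

/-- A set of strings of ordinal length is an antichain iff its elements are
pairwise incomparable under the extension relation. -/
def IsAntichainStr {m : ℕ} (A : Set (OrdStr m)) : Prop :=
  ∀ s ∈ A, ∀ t ∈ A, s ≠ t → ¬ StrExt s t ∧ ¬ StrExt t s

namespace StrLexLt

variable {m : ℕ} {s t : OrdStr m}

theorem not_strExt (h : StrLexLt s t) : ¬ StrExt s t := by
  obtain ⟨ξ, hs, ht, -, hlt⟩ := h
  rintro ⟨_, he⟩
  exact hlt.ne (he ξ hs)

theorem not_strExt_symm (h : StrLexLt s t) : ¬ StrExt t s := by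
  obtain ⟨ξ, hs, ht, -, hlt⟩ := h
  rintro ⟨_, he⟩
  exact hlt.ne' (he ξ ht)

theorem ne (h : StrLexLt s t) : s ≠ t := by
  rintro rfl
  exact h.not_strExt ⟨le_rfl, fun _ _ => rfl⟩

theorem asymm (h : StrLexLt s t) : ¬ StrLexLt t s := by
  obtain ⟨ξ, hs, ht, heq, hlt⟩ := h
  rintro ⟨η, ht', hs', heq', hlt'⟩
  rcases lt_trichotomy ξ η with h | rfl | h
  · exact hlt.ne' (heq' ξ h)
  · exact hlt.asymm hlt'
  · exact hlt'.ne' (heq η h)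

end StrLexLt

/-- Two strings, neither of which extends the other, are lexicographically comparable. -/
theorem strLexLt_or_strLexLt_of_not_strExt {m : ℕ} {s t : OrdStr m}
    (hst : ¬ StrExt s t) (hts : ¬ StrExt t s) : StrLexLt s t ∨ StrLexLt t s := by
  have hex : ∃ ξ : Ordinal, ∃ (hs : ξ < s.len) (ht : ξ < t.len), s.val ξ hs ≠ t.val ξ ht := by
    by_contra! hc
    rcases le_total s.len t.len with h | h
    · exact hst ⟨h, fun ξ hξ => hc ξ hξ (hξ.trans_le h)⟩
    · exact hts ⟨h, fun ξ hξ => (hc ξ (hξ.trans_le h) hξ).symm⟩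
  obtain ⟨ξ, ⟨hs, ht, hne⟩, hmin⟩ := wellFounded_lt.has_min
    {ξ : Ordinal | ∃ (hs : ξ < s.len) (ht : ξ < t.len), s.val ξ hs ≠ t.val ξ ht} hex
  have heq : ∀ η (hη : η < ξ), s.val η (hη.trans hs) = t.val η (hη.trans ht) := fun η hη => by
    by_contra hc
    exact hmin η ⟨hη.trans hs, hη.trans ht, hc⟩ hη
  rcases lt_or_gt_of_ne hne with h | h
  · exact Or.inl ⟨ξ, hs, ht, heq, h⟩
  · exact Or.inr ⟨ξ, ht, hs, fun η hη => (heq η hη).symm, h⟩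

namespace OrdStr

/-- The leading bit of the code `0 ↦ 00`, `1 ↦ 01`, `2 ↦ 11`. -/
def leadingBit (a : Fin 3) : Fin 2 := if a = 2 then 1 else 0

/-- The trailing bit of the code `0 ↦ 00`, `1 ↦ 01`, `2 ↦ 11`. -/
def trailingBit (a : Fin 3) : Fin 2 := if a = 0 then 0 else 1

theorem bits_lt_of_lt : ∀ {a b : Fin 3}, a < b →
    leadingBit a < leadingBit b ∨
      leadingBit a = leadingBit b ∧ trailingBit a < trailingBit b := by
  decide

open Classical in
/-- The binary string obtained from a ternary one by replacing each letter with its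
two-bit code. -/
noncomputable def toBinary (s : OrdStr 3) : OrdStr 2 where
  len := 2 * s.len
  val η hη :=
    let a := s.val (η / 2) ((Ordinal.lt_mul_iff_div_lt two_ne_zero).1 hη)
    if η % 2 = 0 then leadingBit a else trailingBit a

theorem toBinary_val_congr {s t : OrdStr 3} {η : Ordinal} (hs : η < s.toBinary.len)
    (ht : η < t.toBinary.len)
    (h : s.val (η / 2) ((Ordinal.lt_mul_iff_div_lt two_ne_zero).1 hs) =
      t.val (η / 2) ((Ordinal.lt_mul_iff_div_lt two_ne_zero).1 ht)) :
    s.toBinary.val η hs = t.toBinary.val η ht := by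
  simp only [toBinary, h]

theorem two_mul_lt_len (s : OrdStr 3) {ξ : Ordinal} (h : ξ < s.len) :
    2 * ξ < s.toBinary.len :=
  mul_lt_mul_of_pos_left h two_pos

theorem two_mul_add_one_lt_len (s : OrdStr 3) {ξ : Ordinal} (h : ξ < s.len) :
    2 * ξ + 1 < s.toBinary.len := by
  refine (Ordinal.lt_mul_iff_div_lt two_ne_zero).2 ?_
  rwa [Ordinal.mul_add_div _ two_ne_zero, Ordinal.div_eq_zero_of_lt one_lt_two, add_zero]

theorem toBinary_val_two_mul (s : OrdStr 3) {ξ : Ordinal} (h : ξ < s.len) :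
    s.toBinary.val (2 * ξ) (s.two_mul_lt_len h) = leadingBit (s.val ξ h) := by
  simp [toBinary, Ordinal.mul_div_cancel]

theorem toBinary_val_two_mul_add_one (s : OrdStr 3) {ξ : Ordinal} (h : ξ < s.len) :
    s.toBinary.val (2 * ξ + 1) (s.two_mul_add_one_lt_len h) = trailingBit (s.val ξ h) := by
  have hd : (2 * ξ + 1) / 2 = ξ := by
    rw [Ordinal.mul_add_div _ two_ne_zero, Ordinal.div_eq_zero_of_lt one_lt_two, add_zero]
  have hm : (2 * ξ + 1) % 2 = 1 := by
    rw [Ordinal.mul_add_mod_self, Ordinal.mod_eq_of_lt one_lt_two]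
  simp [toBinary, hd, hm]

theorem toBinary_strLexLt {s t : OrdStr 3} (h : StrLexLt s t) :
    StrLexLt s.toBinary t.toBinary := by
  obtain ⟨ξ, hs, ht, heq, hlt⟩ := h
  have hbelow : ∀ η (hη : η < 2 * ξ),
      s.toBinary.val η (hη.trans (s.two_mul_lt_len hs)) =
        t.toBinary.val η (hη.trans (t.two_mul_lt_len ht)) := fun η hη =>
    toBinary_val_congr _ _ (heq _ ((Ordinal.lt_mul_iff_div_lt two_ne_zero).1 hη))
  rcases bits_lt_of_lt hlt with hlead | ⟨hlead, htrail⟩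
  · refine ⟨2 * ξ, s.two_mul_lt_len hs, t.two_mul_lt_len ht, hbelow, ?_⟩
    rwa [toBinary_val_two_mul, toBinary_val_two_mul]
  · refine ⟨2 * ξ + 1, s.two_mul_add_one_lt_len hs, t.two_mul_add_one_lt_len ht, ?_, ?_⟩
    · intro η hη
      rcases (Order.lt_add_one_iff.1 hη).lt_or_eq with h | rfl
      · exact hbelow η h
      · rw [toBinary_val_two_mul s hs, toBinary_val_two_mul t ht, hlead]
    · rwa [toBinary_val_two_mul_add_one, toBinary_val_two_mul_add_one]

end OrdStr

/-- For every antichain `A` of ternary strings of ordinal length there exist an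
antichain `B` of binary strings of ordinal length and an order isomorphism from
`(A, ≤lex)` onto `(B, ≤lex)`. -/
theorem ternary_antichain_iso_binary_antichain
    (A : Set (OrdStr 3)) (hA : IsAntichainStr A) :
    ∃ (B : Set (OrdStr 2)) (g : OrdStr 3 → OrdStr 2),
      IsAntichainStr B ∧ g '' A = B ∧ Set.InjOn g A ∧
      ∀ s ∈ A, ∀ t ∈ A, (StrLexLe s t ↔ StrLexLe (g s) (g t)) := by
  have hcmp : ∀ s ∈ A, ∀ t ∈ A, s ≠ t → StrLexLt s t ∨ StrLexLt t s := fun s hs t ht hne =>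
    strLexLt_or_strLexLt_of_not_strExt (hA s hs t ht hne).1 (hA s hs t ht hne).2
  refine ⟨OrdStr.toBinary '' A, OrdStr.toBinary, ?_, rfl, ?_, ?_⟩
  · rintro _ ⟨s, hs, rfl⟩ _ ⟨t, ht, rfl⟩ hne
    rcases hcmp s hs t ht (fun h => hne (congrArg _ h)) with h | h
    · have h' := OrdStr.toBinary_strLexLt h
      exact ⟨h'.not_strExt, h'.not_strExt_symm⟩
    · have h' := OrdStr.toBinary_strLexLt h
      exact ⟨h'.not_strExt_symm, h'.not_strExt⟩
  · intro s hs t ht heq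
    by_contra hne
    rcases hcmp s hs t ht hne with h | h
    · exact (OrdStr.toBinary_strLexLt h).ne heq
    · exact (OrdStr.toBinary_strLexLt h).ne heq.symm
  · intro s hs t ht
    refine ⟨Or.imp (congrArg _) OrdStr.toBinary_strLexLt, fun hle => ?_⟩
    by_cases hne : s = t
    · exact Or.inl hne
    · refine Or.inr ((hcmp s hs t ht hne).resolve_right fun h => ?_)
      have h' := OrdStr.toBinary_strLexLt h
      exact hle.elim (fun heq => h'.ne heq.symm) h'.asymm
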